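/- Let Ω ⊂ ℝ³ be a bounded domain and let g ∈ BMO(Ω) with ∇g ∈ L(3,∞)(Ω) (weak-L³). Then ‖g‖_{BMO(Ω)} ≤ ‖∇g‖_{L(3,∞)(Ω)}. -/

import Mathlib

open MeasureTheory Set
open scoped ENNReal

noncomputable section

/-- ℝ³ as the pi type `Fin 3 → ℝ`. -/
abbrev E3 := Fin 3 → ℝ

/-- Euclidean dot product on ℝ³. -/
def dot3 (a b : E3) : ℝ := ∑ i, a i * b i

/-- Cross product on ℝ³. -/
def cross3 (a b : E3) : E3 :=
  ![a 1 * b 2 - a 2 * b 1, a 2 * b 0 - a 0 * b 2, a 0 * b 1 - a 1 * b 0]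

/-- Euclidean distance on ℝ³. -/
def edist3 (x y : E3) : ℝ := Real.sqrt (∑ i, (x i - y i) ^ 2)

/-- Partial derivative of a scalar function in direction `i`. -/
def pd (f : E3 → ℝ) (i : Fin 3) (x : E3) : ℝ := fderiv ℝ f x (Pi.single i 1)

/-- Gradient of a scalar field. -/
def grad3 (f : E3 → ℝ) (x : E3) : E3 := fun i => pd f i x

/-- Divergence of a vector field. -/
def div3 (u : E3 → E3) (x : E3) : ℝ := ∑ i, pd (fun y => u y i) i x

/-- Curl of a vector field. -/
def curl3 (u : E3 → E3) (x : E3) : E3 :=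
  ![pd (fun y => u y 2) 1 x - pd (fun y => u y 1) 2 x,
    pd (fun y => u y 0) 2 x - pd (fun y => u y 2) 0 x,
    pd (fun y => u y 1) 0 x - pd (fun y => u y 0) 1 x]

/-- Pointwise norm of the full Jacobian of a vector field. -/
def jacNorm (u : E3 → E3) (x : E3) : ℝ := ∑ i, ‖grad3 (fun y => u y i) x‖

/-- A (closed, axis-parallel) cube in ℝ³. -/
def IsCube (Q : Set E3) : Prop :=
  ∃ (c : E3) (r : ℝ), 0 < r ∧ Q = {x | ∀ i, |x i - c i| ≤ r}

/-- The nonincreasing rearrangement of `f` with respect to the measure `μ`. -/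
def rearr (μ : Measure E3) (f : E3 → ℝ) (t : ℝ) : ℝ :=
  sInf {s : ℝ | 0 < s ∧ μ {x | s < |f x|} ≤ ENNReal.ofReal t}

/-- The Lorentz quasi-norm `‖f‖_{L(m,q)(μ)}`, with value in `ℝ≥0∞`. -/
def lorentzNorm (μ : Measure E3) (f : E3 → ℝ) (m : ℝ) (q : ℝ≥0∞) : ℝ≥0∞ :=
  if q = ∞ then ⨆ t ∈ Ioi (0 : ℝ), ENNReal.ofReal (t ^ (1 / m) * rearr μ f t)
  else (∫⁻ t in Ioi (0 : ℝ),
      ENNReal.ofReal ((t ^ (1 / m) * rearr μ f t) ^ q.toReal / t)) ^ (1 / q.toReal)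

/-- The Lorentz quasi-norm of a vector field, applied to its pointwise norm. -/
def lorentzNormV (μ : Measure E3) (u : E3 → E3) (m : ℝ) (q : ℝ≥0∞) : ℝ≥0∞ :=
  lorentzNorm μ (fun x => ‖u x‖) m q

/-- An `H_{μ₀}` atom with respect to the cube `Q`. -/
structure IsHAtom (μ₀ : ℝ) (Q : Set E3) (a : E3 → ℝ) : Prop where
  meas : Measurable a
  cube : IsCube Q
  supp : ∀ x, x ∉ Q → a x = 0
  bdd : ∀ᵐ x ∂(volume : Measure E3), |a x| ≤ ((volume Q).toReal)⁻¹
  cancel : ∃ μ : ℝ, μ₀ ≤ μ ∧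
    ((volume Q).toReal < 1 → |∫ x in Q, a x| ≤ (volume Q).toReal ^ μ)

/-- An atomic decomposition of `f` on `Ω` in the Hardy space `H_{μ₀}(Ω)`. -/
def IsHardyDecomp (Ω : Set E3) (μ₀ : ℝ) (f : E3 → ℝ)
    (lam : ℕ → ℝ) (a : ℕ → E3 → ℝ) (Q : ℕ → Set E3) : Prop :=
  (∀ k, IsHAtom μ₀ (Q k) (a k) ∧ Q k ⊆ Ω) ∧ Summable (fun k => |lam k|) ∧
    ∀ x ∈ Ω, f x = ∑' k, lam k * a k x

/-- Membership in the atomic Hardy space `H_{μ₀}(Ω)`. -/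
def MemHardy (Ω : Set E3) (μ₀ : ℝ) (f : E3 → ℝ) : Prop :=
  ∃ lam a Q, IsHardyDecomp Ω μ₀ f lam a Q

/-- The atomic Hardy norm `‖f‖_{H_{μ₀}(Ω)}`. -/
def hardyNorm (Ω : Set E3) (μ₀ : ℝ) (f : E3 → ℝ) : ℝ :=
  sInf {S : ℝ | ∃ lam a Q, IsHardyDecomp Ω μ₀ f lam a Q ∧ S = ∑' k, |lam k|}

/-- Componentwise membership of a vector field in `H_{μ₀}(Ω)`. -/
def MemHardyV (Ω : Set E3) (μ₀ : ℝ) (u : E3 → E3) : Prop :=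
  ∀ i, MemHardy Ω μ₀ (fun x => u x i)

/-- Hardy norm of a vector field: sum of the Hardy norms of its components. -/
def hardyNormV (Ω : Set E3) (μ₀ : ℝ) (u : E3 → E3) : ℝ :=
  ∑ i : Fin 3, hardyNorm Ω μ₀ (fun x => u x i)

/-- Mean value of `g` over `Q` (w.r.t. Lebesgue measure). -/
def avgQ (Q : Set E3) (g : E3 → ℝ) : ℝ := ((volume Q).toReal)⁻¹ * ∫ x in Q, g x

/-- The set of mean oscillations of `g` over cubes contained in `Ω`. -/
def bmoSet (Ω : Set E3) (g : E3 → ℝ) : Set ℝ :=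
  {A | ∃ Q, IsCube Q ∧ Q ⊆ Ω ∧
    A = ((volume Q).toReal)⁻¹ * ∫ x in Q, |g x - avgQ Q g|}

/-- The BMO seminorm of `g` on `Ω`. -/
def bmoNorm (Ω : Set E3) (g : E3 → ℝ) : ℝ := sSup (bmoSet Ω g)

/-- Membership in `BMO(Ω)`. -/
def MemBMO (Ω : Set E3) (g : E3 → ℝ) : Prop :=
  LocallyIntegrableOn g Ω ∧ BddAbove (bmoSet Ω g)

/-- A bounded domain in ℝ³. -/
def BoundedDomain (Ω : Set E3) : Prop :=
  IsOpen Ω ∧ IsConnected Ω ∧ Bornology.IsBounded Ω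

/-- `Ω` has `C²` boundary: near each boundary point, `Ω` is the sublevel set of a
`C²` function with nonvanishing differential. -/
def C2Boundary (Ω : Set E3) : Prop :=
  ∀ x ∈ frontier Ω, ∃ (U : Set E3) (f : E3 → ℝ), IsOpen U ∧ x ∈ U ∧
    ContDiff ℝ 2 f ∧ (∀ y ∈ U, fderiv ℝ f y ≠ 0) ∧ Ω ∩ U = {y | f y < 0} ∩ U

/-- `ν` is an outward unit normal field for `Ω`: it has unit length on the boundary
and every differentiable curve staying in `closure Ω` has inward-pointing velocity. -/
def IsOutwardNormal (Ω : Set E3) (ν : E3 → E3) : Prop :=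
  ∀ x ∈ frontier Ω, ‖ν x‖ = 1 ∧
    ∀ γ : ℝ → E3, γ 0 = x → DifferentiableAt ℝ γ 0 →
      (∀ t : ℝ, 0 ≤ t → γ t ∈ closure Ω) → dot3 (deriv γ 0) (ν x) ≤ 0

/-- `u ∈ C^{1,α}(closure Ω)`: continuously differentiable with `α`-Hölder derivative. -/
def HolderC1 (α : ℝ) (Ω : Set E3) (u : E3 → E3) : Prop :=
  ContDiffOn ℝ 1 u (closure Ω) ∧ ∃ C : ℝ, ∀ x ∈ closure Ω, ∀ y ∈ closure Ω,
    ‖fderivWithin ℝ u (closure Ω) x - fderivWithin ℝ u (closure Ω) y‖ ≤ C * ‖x - y‖ ^ α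

/-- The Neumann harmonic fields `H₁(Ω)`. -/
def MemH1 (Ω : Set E3) (ν : E3 → E3) (h : E3 → E3) : Prop :=
  ContDiffOn ℝ 2 h Ω ∧ (∀ x ∈ Ω, div3 h x = 0 ∧ curl3 h x = 0) ∧
    ∀ x ∈ frontier Ω, dot3 (ν x) (h x) = 0

/-- The Dirichlet harmonic fields `H₂(Ω)`. -/
def MemH2 (Ω : Set E3) (ν : E3 → E3) (h : E3 → E3) : Prop :=
  ContDiffOn ℝ 2 h Ω ∧ (∀ x ∈ Ω, div3 h x = 0 ∧ curl3 h x = 0) ∧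
    ∀ x ∈ frontier Ω, cross3 (ν x) (h x) = 0

open ProbabilityTheory

/-- A Wirtinger-type inequality for functions vanishing at the left endpoint. -/
lemma integral_sq_le_of_zero {u u' : ℝ → ℝ} {r : ℝ} (hr : 0 < r)
    (hu : ∀ x ∈ Icc 0 r, HasDerivAt u (u' x) x) (h0 : u 0 = 0)
    (hint : IntervalIntegrable (fun x => u' x ^ 2) volume 0 r) :
    ∫ x in 0..r, u x ^ 2 ≤ 4 * r ^ 2 / 9 * ∫ x in 0..r, u' x ^ 2 := by
  set k : ℝ := 3 / (2 * r) with hk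
  have hkr : k * r = 3 / 2 := by rw [hk]; field_simp
  have hk0 : 0 < k := by positivity
  have hucont : ContinuousOn u (Icc 0 r) := fun x hx => (hu x hx).continuousAt.continuousWithinAt
  have hcos : ∀ x ∈ Icc 0 r, Real.cos (k * (r - x)) ≠ 0 := fun x hx => by
    have h1 : 0 ≤ k * (r - x) := mul_nonneg hk0.le (by linarith [hx.2])
    have h2 : k * (r - x) ≤ 3 / 2 := by nlinarith [hx.1]
    exact (Real.cos_pos_of_mem_Ioo ⟨by linarith [Real.pi_gt_three], by
      linarith [Real.pi_gt_three]⟩).ne'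
  have hG : ∀ x ∈ Icc 0 r, HasDerivAt (fun x => u x ^ 2 * (k * Real.tan (k * (r - x))))
      (2 * u x * u' x * (k * Real.tan (k * (r - x))) +
        u x ^ 2 * (-k ^ 2 * (1 + Real.tan (k * (r - x)) ^ 2))) x := fun x hx => by
    have h1 : HasDerivAt (fun x => k * (r - x)) (-k) x := by
      simpa using ((hasDerivAt_id x).const_sub r).const_mul k
    have h2 := ((Real.hasDerivAt_tan (hcos x hx)).comp x h1).const_mul k
    refine (((hu x hx).pow 2).mul h2).congr_deriv ?_
    rw [← Real.inv_one_add_tan_sq (hcos x hx)]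
    simp only [Function.comp, one_div, inv_inv, Pi.pow_apply, Nat.cast_ofNat]
    ring
  have hui : IntervalIntegrable (fun x => u x ^ 2) volume 0 r := by
    apply ContinuousOn.intervalIntegrable
    rw [uIcc_of_le hr.le]
    exact hucont.pow 2
  have hφ : IntervalIntegrable (fun x => u' x ^ 2 - k ^ 2 * u x ^ 2) volume 0 r :=
    hint.sub (hui.const_mul _)
  have key := intervalIntegral.sub_le_integral_of_hasDeriv_right_of_le hr.le
    (fun x hx => (hG x hx).continuousAt.continuousWithinAt)
    (fun x hx => (hG x (Ioo_subset_Icc_self hx)).hasDerivWithinAt)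
    ((intervalIntegrable_iff_integrableOn_Icc_of_le hr.le).1 hφ)
    (fun x _ => by nlinarith [sq_nonneg (u' x - u x * (k * Real.tan (k * (r - x))))])
  rw [intervalIntegral.integral_sub hint (hui.const_mul _), intervalIntegral.integral_const_mul,
    h0] at key
  simp only [sub_self, mul_zero, Real.tan_zero] at key
  have hc : 4 * r ^ 2 / 9 = (k ^ 2)⁻¹ := by rw [hk]; field_simp; norm_num
  rw [hc, inv_mul_eq_div, le_div_iff₀ (by positivity)]
  linarith

lemma integral_sub_mid_sq_le {h : ℝ → ℝ} {c r : ℝ} (hr : 0 < r)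
    (hd : ∀ x ∈ Icc (c - r) (c + r), DifferentiableAt ℝ h x)
    (hint : IntervalIntegrable (fun x => deriv h x ^ 2) volume (c - r) (c + r)) :
    ∫ x in (c - r)..(c + r), (h x - h c) ^ 2 ≤
      4 * r ^ 2 / 9 * ∫ x in (c - r)..(c + r), deriv h x ^ 2 := by
  have hcont : ContinuousOn (fun x => (h x - h c) ^ 2) (Icc (c - r) (c + r)) := fun x hx =>
    (((hd x hx).continuousAt.sub continuousAt_const).pow 2).continuousWithinAt
  have hi : IntervalIntegrable (fun x => (h x - h c) ^ 2) volume (c - r) (c + r) := by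
    apply ContinuousOn.intervalIntegrable
    rwa [uIcc_of_le (by linarith)]
  have hmem : c ∈ uIcc (c - r) (c + r) := by
    rw [uIcc_of_le (by linarith)]; constructor <;> linarith
  have s1 := uIcc_subset_uIcc_left hmem
  have s2 := uIcc_subset_uIcc_right hmem
  have e1 : ∫ x in 0..r, (h (c + x) - h c) ^ 2 = ∫ x in c..(c + r), (h x - h c) ^ 2 := by
    simpa using intervalIntegral.integral_comp_add_left (fun x => (h x - h c) ^ 2) c
      (a := 0) (b := r)
  have e2 : ∫ x in 0..r, (h (c - x) - h c) ^ 2 = ∫ x in (c - r)..c, (h x - h c) ^ 2 := by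
    simpa using intervalIntegral.integral_comp_sub_left (fun x => (h x - h c) ^ 2) c
      (a := 0) (b := r)
  have e3 : ∫ x in 0..r, deriv h (c + x) ^ 2 = ∫ x in c..(c + r), deriv h x ^ 2 := by
    simpa using intervalIntegral.integral_comp_add_left (fun x => deriv h x ^ 2) c
      (a := 0) (b := r)
  have e4 : ∫ x in 0..r, (-deriv h (c - x)) ^ 2 = ∫ x in (c - r)..c, deriv h x ^ 2 := by
    simpa using intervalIntegral.integral_comp_sub_left (fun x => deriv h x ^ 2) c
      (a := 0) (b := r)
  have k1 := integral_sq_le_of_zero (u := fun x => h (c + x) - h c)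
    (u' := fun x => deriv h (c + x)) hr
    (fun x hx => by
      have := (hd (c + x) ⟨by linarith [hx.1], by linarith [hx.2]⟩).hasDerivAt
      exact (this.comp_const_add c x).sub_const _)
    (by simp)
    (by simpa using (hint.mono_set s2).comp_add_left c)
  have k2 := integral_sq_le_of_zero (u := fun x => h (c - x) - h c)
    (u' := fun x => -deriv h (c - x)) hr
    (fun x hx => by
      have := (hd (c - x) ⟨by linarith [hx.2], by linarith [hx.1]⟩).hasDerivAt
      exact (this.comp_const_sub c x).sub_const _)
    (by simp)
    (by simpa using ((hint.mono_set s1).comp_sub_left c).symm)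
  rw [← intervalIntegral.integral_add_adjacent_intervals (hi.mono_set s1) (hi.mono_set s2),
    ← intervalIntegral.integral_add_adjacent_intervals (hint.mono_set s1) (hint.mono_set s2)]
  rw [e1, e3] at k1
  rw [e2, e4] at k2
  linarith

lemma lintegral_sub_mid_sq_le {h : ℝ → ℝ} {c r : ℝ} (hr : 0 < r)
    (hd : ∀ x ∈ Icc (c - r) (c + r), DifferentiableAt ℝ h x) :
    ∫⁻ x in Icc (c - r) (c + r), ENNReal.ofReal ((h x - h c) ^ 2) ≤
      ENNReal.ofReal (4 * r ^ 2 / 9) *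
        ∫⁻ x in Icc (c - r) (c + r), ENNReal.ofReal (deriv h x ^ 2) := by
  by_cases htop : ∫⁻ x in Icc (c - r) (c + r), ENNReal.ofReal (deriv h x ^ 2) = ∞
  · rw [htop, ENNReal.mul_top (by positivity)]
    exact le_top
  have hle : c - r ≤ c + r := by linarith
  have hint : IntegrableOn (fun x => deriv h x ^ 2) (Icc (c - r) (c + r)) := by
    refine ⟨((measurable_deriv h).pow_const 2).aestronglyMeasurable, ?_⟩
    rw [hasFiniteIntegral_iff_ofReal (.of_forall fun x => sq_nonneg _)]
    exact Ne.lt_top htop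
  have hcont : ContinuousOn (fun x => (h x - h c) ^ 2) (Icc (c - r) (c + r)) := fun x hx =>
    (((hd x hx).continuousAt.sub continuousAt_const).pow 2).continuousWithinAt
  rw [← ofReal_integral_eq_lintegral_ofReal hint (.of_forall fun x => sq_nonneg _),
    ← ofReal_integral_eq_lintegral_ofReal hcont.integrableOn_Icc (.of_forall fun x => sq_nonneg _),
    ← ENNReal.ofReal_mul (by positivity)]
  apply ENNReal.ofReal_le_ofReal
  have := integral_sub_mid_sq_le hr hd ((intervalIntegrable_iff_integrableOn_Icc_of_le hle).2 hint)
  simpa only [intervalIntegral.integral_of_le hle, ← integral_Icc_eq_integral_Ioc] using this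

/-- Second moment bound from a weak-`L³` bound on the distribution function. -/
lemma lintegral_sq_le_of_meas_lt_le {α : Type*} [MeasurableSpace α] {μ : Measure α} {f : α → ℝ}
    (hf : Measurable f) (hf0 : 0 ≤ f) {L M : ℝ} (hL : 0 < L) (hM : 0 < M)
    (hμ : μ univ ≤ ENNReal.ofReal (L ^ 3))
    (hw : ∀ s, 0 < s → μ {x | s < f x} ≤ ENNReal.ofReal (M ^ 3 / s ^ 3)) :
    ∫⁻ x, ENNReal.ofReal (f x ^ 2) ∂μ ≤ ENNReal.ofReal (3 * M ^ 2 * L) := by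
  have hs : 0 < M / L := by positivity
  have h2 := lintegral_rpow_eq_lintegral_meas_lt_mul μ (.of_forall hf0) hf.aemeasurable
    (p := 2) (by norm_num)
  simp only [Real.rpow_two] at h2
  rw [h2, ← Ioc_union_Ioi_eq_Ioi hs.le]
  have i1 : ∫⁻ t in Ioc 0 (M / L), μ {a | t < f a} * ENNReal.ofReal (t ^ ((2 : ℝ) - 1)) ≤
      ENNReal.ofReal (M ^ 2 * L / 2) := by
    calc _ ≤ ∫⁻ t in Ioc 0 (M / L), ENNReal.ofReal (L ^ 3 * t) := by
          refine setLIntegral_mono (by fun_prop) fun t ht => ?_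
          rw [ENNReal.ofReal_mul (by positivity)]
          norm_num
          gcongr
          exact (measure_mono (subset_univ _)).trans hμ
      _ = ENNReal.ofReal (∫ t in Ioc 0 (M / L), L ^ 3 * t) := by
          rw [ofReal_integral_eq_lintegral_ofReal]
          · exact (Continuous.integrableOn_Ioc (by fun_prop))
          · filter_upwards [ae_restrict_mem measurableSet_Ioc] with t ht
            exact mul_nonneg (by positivity) ht.1.le
      _ = _ := by
          rw [← intervalIntegral.integral_of_le hs.le, intervalIntegral.integral_const_mul,
            integral_id]
          congr 1
          field_simp
          ring
  have i2 : ∫⁻ t in Ioi (M / L), μ {a | t < f a} * ENNReal.ofReal (t ^ ((2 : ℝ) - 1)) ≤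
      ENNReal.ofReal (M ^ 2 * L) := by
    calc _ ≤ ∫⁻ t in Ioi (M / L), ENNReal.ofReal (M ^ 3 * t ^ (-2 : ℝ)) := by
          refine setLIntegral_mono (by fun_prop) fun t ht => ?_
          have ht0 : 0 < t := hs.trans ht
          refine (mul_le_mul_left (hw t ht0) _).trans ?_
          rw [← ENNReal.ofReal_mul (by positivity)]
          apply ENNReal.ofReal_le_ofReal
          norm_num [Real.rpow_neg ht0.le]
          apply le_of_eq
          field_simp
      _ = ENNReal.ofReal (∫ t in Ioi (M / L), M ^ 3 * t ^ (-2 : ℝ)) := by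
          rw [ofReal_integral_eq_lintegral_ofReal]
          · exact (integrableOn_Ioi_rpow_of_lt (by norm_num) hs).const_mul _
          · filter_upwards [ae_restrict_mem measurableSet_Ioi] with t ht
            have ht0 : 0 < t := hs.trans ht
            positivity
      _ = _ := by
          rw [integral_const_mul, integral_Ioi_rpow_of_lt (by norm_num) hs]
          congr 1
          norm_num [Real.rpow_neg hs.le]
          field_simp
  calc _ ≤ ENNReal.ofReal 2 * (ENNReal.ofReal (M ^ 2 * L / 2) + ENNReal.ofReal (M ^ 2 * L)) := by
        gcongr
        exact (lintegral_union_le _ _ _).trans (add_le_add i1 i2)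
    _ = _ := by
        rw [← ENNReal.ofReal_add (by positivity) (by positivity), ← ENNReal.ofReal_mul (by norm_num)]
        congr 1
        ring

lemma evariance_le_lintegral_sub_sq {α : Type*} [MeasurableSpace α] {μ : Measure α}
    [IsProbabilityMeasure μ] {X : α → ℝ} (hX : MemLp X 2 μ) (a : ℝ) :
    evariance X μ ≤ ∫⁻ x, ENNReal.ofReal ((X x - a) ^ 2) ∂μ := by
  have hXa : MemLp (fun x => X x - a) 2 μ := hX.sub (memLp_const a)
  rw [← ofReal_variance hX, ← variance_sub_const hX.aestronglyMeasurable a,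
    ← ofReal_integral_eq_lintegral_ofReal hXa.integrable_sq (.of_forall fun x => sq_nonneg _)]
  exact ENNReal.ofReal_le_ofReal (variance_le_expectation_sq hXa.aestronglyMeasurable)

lemma memLp_two_of_bound {α : Type*} [MeasurableSpace α] {μ : Measure α} [IsFiniteMeasure μ]
    {X : α → ℝ} (hX : Measurable X) {C : ℝ} (hC : ∀ x, |X x| ≤ C) : MemLp X 2 μ :=
  MemLp.of_bound hX.aestronglyMeasurable C (.of_forall hC)

lemma sq_integral_le_integral_sq {α : Type*} [MeasurableSpace α] {μ : Measure α}
    [IsProbabilityMeasure μ] {X : α → ℝ} (hX : MemLp X 2 μ) :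
    (∫ x, X x ∂μ) ^ 2 ≤ ∫ x, X x ^ 2 ∂μ := by
  have := variance_nonneg X μ
  rw [variance_eq_sub hX] at this
  simpa using this

lemma lintegral_sub_sq_le {α : Type*} [MeasurableSpace α] {μ : Measure α}
    [IsProbabilityMeasure μ] {X : α → ℝ} (hX : MemLp X 2 μ) (m : ℝ) :
    ∫⁻ x, ENNReal.ofReal ((X x - m) ^ 2) ∂μ ≤
      evariance X μ + ENNReal.ofReal ((∫ x, X x ∂μ - m) ^ 2) := by
  have hXm : MemLp (fun x => X x - m) 2 μ := hX.sub (memLp_const m)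
  have hv := variance_eq_sub hXm
  rw [variance_sub_const hX.aestronglyMeasurable,
    integral_sub (hX.integrable one_le_two) (integrable_const m)] at hv
  rw [← ofReal_variance hX, ← ofReal_integral_eq_lintegral_ofReal hXm.integrable_sq
    (.of_forall fun x => sq_nonneg _), ← ENNReal.ofReal_add (variance_nonneg _ _) (sq_nonneg _)]
  apply ENNReal.ofReal_le_ofReal
  simp at hv ⊢
  linarith

/-- The Efron–Stein inequality for two independent factors. -/
lemma evariance_prod_le {α β : Type*} [MeasurableSpace α] [MeasurableSpace β] {μ : Measure α}
    {ν : Measure β} [IsProbabilityMeasure μ] [IsProbabilityMeasure ν] {F : α × β → ℝ}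
    (hF : Measurable F) {C : ℝ} (hC : ∀ z, |F z| ≤ C) :
    evariance F (μ.prod ν) ≤ ∫⁻ y, evariance (fun x => F (x, y)) μ ∂ν +
      ∫⁻ x, evariance (fun y => F (x, y)) ν ∂μ := by
  have hLp : MemLp F 2 (μ.prod ν) := memLp_two_of_bound hF hC
  have hFx : ∀ x, MemLp (fun y => F (x, y)) 2 ν := fun x =>
    memLp_two_of_bound (by fun_prop) fun y => hC _
  set b : β → ℝ := fun y => ∫ x, F (x, y) ∂μ
  have hb : Measurable b :=
    (hF.stronglyMeasurable.integral_prod_left').measurable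
  have hbC : ∀ y, |b y| ≤ C := fun y => by
    simpa using norm_integral_le_of_norm_le_const (μ := μ) (f := fun x => F (x, y))
      (.of_forall fun x => hC _)
  have hbLp : MemLp b 2 ν := memLp_two_of_bound hb hbC
  have hm : ∫ z, F z ∂(μ.prod ν) = ∫ y, b y ∂ν :=
    integral_prod_symm F (hLp.integrable one_le_two)
  have hx : ∀ x, ∫⁻ y, ENNReal.ofReal ((F (x, y) - ∫ z, F z ∂(μ.prod ν)) ^ 2) ∂ν ≤
      evariance (fun y => F (x, y)) ν + ∫⁻ y, ENNReal.ofReal ((F (x, y) - b y) ^ 2) ∂ν := by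
    intro x
    have hd : MemLp (fun y => F (x, y) - b y) 2 ν := (hFx x).sub hbLp
    refine (lintegral_sub_sq_le (hFx x) _).trans ?_
    gcongr
    rw [hm, ← integral_sub ((hFx x).integrable one_le_two) (hbLp.integrable one_le_two),
      ← ofReal_integral_eq_lintegral_ofReal hd.integrable_sq (.of_forall fun x => sq_nonneg _)]
    exact ENNReal.ofReal_le_ofReal (sq_integral_le_integral_sq hd)
  rw [evariance_eq_lintegral_ofReal, lintegral_prod _ (by fun_prop)]
  refine (lintegral_mono hx).trans ?_
  rw [lintegral_add_right _ (Measurable.lintegral_prod_right (by fun_prop)), add_comm,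
    lintegral_lintegral_swap (by fun_prop)]
  simp only [evariance_eq_lintegral_ofReal]
  rfl

/-- Tensorization of Poincaré-type variance bounds over finite products. -/
lemma evariance_pi_le {n : ℕ} (μ : Fin n → Measure ℝ) [∀ i, IsProbabilityMeasure (μ i)]
    {F : (Fin n → ℝ) → ℝ} (hF : Measurable F) {C : ℝ} (hC : ∀ z, |F z| ≤ C)
    {G : Fin n → (Fin n → ℝ) → ℝ≥0∞} (hG : ∀ i, Measurable (G i))
    (h : ∀ i x, evariance (fun s => F (Function.update x i s)) (μ i) ≤
      ∫⁻ s, G i (Function.update x i s) ∂(μ i)) :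
    evariance F (Measure.pi μ) ≤ ∑ i, ∫⁻ x, G i x ∂(Measure.pi μ) := by
  induction n with
  | zero =>
    have : F = fun _ => F default := funext fun x => congrArg F (Subsingleton.elim _ _)
    rw [this, evariance_eq_lintegral_ofReal]
    simp
  | succ n ih =>
    have hmp := (measurePreserving_piFinSuccAbove μ 0).symm
    set ν := Measure.pi fun j => μ (Fin.succAbove 0 j)
    have hmp' : MeasurePreserving
        (fun z : ℝ × (Fin n → ℝ) => (Fin.cons z.1 z.2 : Fin (n + 1) → ℝ))
        ((μ 0).prod ν) (Measure.pi μ) := by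
      convert hmp using 1
      funext z
      exact (Fin.insertNth_zero' z.1 z.2).symm
    have hcons := hmp'.measurable
    have hFc : Measurable fun z : ℝ × (Fin n → ℝ) => F (Fin.cons z.1 z.2) := hF.comp hcons
    have hGc : ∀ i, Measurable fun z : ℝ × (Fin n → ℝ) => G i (Fin.cons z.1 z.2) :=
      fun i => (hG i).comp hcons
    have hev : evariance F (Measure.pi μ) =
        evariance (fun z : ℝ × (Fin n → ℝ) => F (Fin.cons z.1 z.2)) ((μ 0).prod ν) := by
      rw [evariance_eq_lintegral_ofReal, evariance_eq_lintegral_ofReal, ← hmp'.map_eq,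
        lintegral_map (by fun_prop) hcons, integral_map hcons.aemeasurable hF.aestronglyMeasurable]
    rw [hev, Fin.sum_univ_succ]
    simp_rw [← hmp'.lintegral_comp (hG _)]
    refine (evariance_prod_le hFc fun z => hC _).trans (add_le_add ?_ ?_)
    · rw [lintegral_prod_symm' _ (hGc 0)]
      refine lintegral_mono fun y => ?_
      simpa [Fin.update_cons_zero] using h 0 (Fin.cons 0 y)
    · have hs : ∀ x : ℝ, evariance (fun y : Fin n → ℝ => F (Fin.cons x y)) ν ≤
          ∑ i : Fin n, ∫⁻ y, G i.succ (Fin.cons x y) ∂ν := fun x => by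
        refine ih (fun j => μ (Fin.succAbove 0 j)) (F := fun y => F (Fin.cons x y))
          (G := fun i y => G i.succ (Fin.cons x y))
          (hFc.comp measurable_prodMk_left) (fun z => hC _)
          (fun i => (hGc i.succ).comp measurable_prodMk_left) fun i y => ?_
        simpa [Fin.cons_update] using h i.succ (Fin.cons x y)
      refine (lintegral_mono hs).trans ?_
      rw [lintegral_finsetSum _ fun i _ => (hGc i.succ).lintegral_prod_right']
      refine Finset.sum_le_sum fun i _ => ?_
      rw [lintegral_prod _ (hGc i.succ).aemeasurable]

lemma meas_lt_le_of_lorentzNorm_lt {μ : Measure E3} [IsFiniteMeasure μ] {f : E3 → ℝ}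
    (hf : Measurable f) {M : ℝ} (hM : 0 < M) (hfM : lorentzNorm μ f 3 ∞ < ENNReal.ofReal M)
    {s : ℝ} (hs : 0 < s) : μ {x | s < |f x|} ≤ ENNReal.ofReal (M ^ 3 / s ^ 3) := by
  set t : ℝ := M ^ 3 / s ^ 3 with ht
  have ht0 : 0 < t := by positivity
  have htr : t ^ (1 / 3 : ℝ) = M / s := by
    rw [ht, ← div_pow, ← Real.rpow_natCast, ← Real.rpow_mul (by positivity)]
    norm_num
  have h1 : ENNReal.ofReal (t ^ (1 / 3 : ℝ) * rearr μ f t) < ENNReal.ofReal M := by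
    refine lt_of_le_of_lt ?_ hfM
    rw [lorentzNorm, if_pos rfl]
    exact le_iSup₂ (f := fun t (_ : t ∈ Ioi (0 : ℝ)) =>
      ENNReal.ofReal (t ^ (1 / 3 : ℝ) * rearr μ f t)) t ht0
  have h2 : rearr μ f t < s := by
    have := (ENNReal.ofReal_lt_ofReal_iff hM).1 h1
    rw [htr, div_mul_eq_mul_div, div_lt_iff₀ hs] at this
    exact lt_of_mul_lt_mul_left this hM.le
  have hne : {s : ℝ | 0 < s ∧ μ {x | s < |f x|} ≤ ENNReal.ofReal t}.Nonempty := by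
    have hlim : Filter.Tendsto (fun n : ℕ => μ {x | (n : ℝ) < |f x|}) Filter.atTop (nhds 0) := by
      have := tendsto_measure_iInter_atTop (μ := μ) (s := fun n : ℕ => {x | (n : ℝ) < |f x|})
        (fun n => (measurableSet_lt measurable_const (by fun_prop)).nullMeasurableSet)
        (fun a b hab x (hx : (b : ℝ) < |f x|) =>
          show (a : ℝ) < |f x| from lt_of_le_of_lt (Nat.cast_le.2 hab) hx) ⟨0, measure_ne_top _ _⟩
      have he : ⋂ n : ℕ, {x | (n : ℝ) < |f x|} = ∅ := by
        refine eq_empty_of_forall_notMem fun x hx => ?_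
        obtain ⟨n, hn⟩ := exists_nat_gt |f x|
        exact absurd (mem_iInter.1 hx n) (not_lt.2 hn.le)
      rwa [he, measure_empty] at this
    obtain ⟨n, hn, hn0⟩ := ((hlim.eventually_lt_const (ENNReal.ofReal_pos.2 ht0)).and
      (Filter.eventually_gt_atTop 0)).exists
    exact ⟨n, Nat.cast_pos.2 hn0, hn.le⟩
  obtain ⟨s', ⟨-, hs'⟩, hss⟩ := exists_lt_of_csInf_lt hne h2
  exact (measure_mono fun x hx => hss.trans hx).trans hs'

lemma measurable_norm_grad3 (g : E3 → ℝ) : Measurable fun x => ‖grad3 g x‖ :=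
  (measurable_pi_lambda _ fun i => measurable_fderiv_apply_const ℝ g (Pi.single i 1)).norm

lemma cube_eq_pi (c : E3) (r : ℝ) :
    {x : E3 | ∀ i, |x i - c i| ≤ r} = univ.pi fun i => Icc (c i - r) (c i + r) := by
  ext x
  simp only [mem_ofPred_eq, mem_univ_pi, mem_Icc, abs_sub_le_iff]
  exact forall_congr' fun i => ⟨fun h => ⟨by linarith, by linarith⟩,
    fun h => ⟨by linarith, by linarith⟩⟩

lemma volume_cube (c : E3) {r : ℝ} (hr : 0 < r) :
    volume (univ.pi fun i => Icc (c i - r) (c i + r)) = ENNReal.ofReal ((2 * r) ^ 3) := by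
  rw [volume_pi_pi]
  simp only [Real.volume_Icc]
  rw [Fin.prod_univ_three, ← ENNReal.ofReal_mul (by linarith), ← ENNReal.ofReal_mul (by nlinarith)]
  congr 1
  ring

lemma pi_cond_Icc (c : E3) (r : ℝ) (hr : 0 < r) :
    Measure.pi (fun i => volume[|Icc (c i - r) (c i + r)]) =
      volume[|univ.pi fun i => Icc (c i - r) (c i + r)] := by
  have hp : ∀ i, IsProbabilityMeasure (volume[|Icc (c i - r) (c i + r)]) := fun i =>
    cond_isProbabilityMeasure_of_finite (by simp [hr]) (by simp)
  refine Measure.pi_eq fun s hs => ?_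
  rw [cond_apply (MeasurableSet.univ_pi fun i => measurableSet_Icc), ← pi_inter_distrib,
    volume_pi_pi, volume_pi_pi]
  simp only [cond_apply measurableSet_Icc]
  rw [Finset.prod_mul_distrib]
  congr 1
  have e : ∀ i, volume (Icc (c i - r) (c i + r)) = ENNReal.ofReal (2 * r) := fun i => by
    rw [Real.volume_Icc]; congr 1; ring
  simp only [e, Finset.prod_const, ENNReal.inv_pow]

/-- The coordinatewise projection onto a cube. -/
def cubeProj (c : E3) (r : ℝ) (x : E3) : E3 := fun i => max (c i - r) (min (c i + r) (x i))

lemma continuous_cubeProj (c : E3) (r : ℝ) : Continuous (cubeProj c r) := by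
  unfold cubeProj
  fun_prop

lemma cubeProj_mem (c : E3) {r : ℝ} (hr : 0 < r) (x : E3) :
    cubeProj c r x ∈ univ.pi fun i => Icc (c i - r) (c i + r) := fun i _ =>
  ⟨le_max_left _ _, max_le (by linarith) (min_le_left _ _)⟩

lemma cubeProj_of_mem {c : E3} {r : ℝ} {x : E3}
    (hx : x ∈ univ.pi fun i => Icc (c i - r) (c i + r)) : cubeProj c r x = x := by
  funext i
  have := hx i trivial
  rw [cubeProj, min_eq_right this.2, max_eq_right this.1]

lemma cubeProj_update {c : E3} {r : ℝ} (x : E3) {i : Fin 3} {s : ℝ}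
    (hs : s ∈ Icc (c i - r) (c i + r)) :
    cubeProj c r (Function.update x i s) = Function.update (cubeProj c r x) i s := by
  funext j
  by_cases h : j = i
  · subst h
    simp [cubeProj, hs.1, hs.2]
  · simp [cubeProj, h]

/-- Wirtinger's inequality on a normalized interval, in variance form. -/
lemma evariance_cond_Icc_le {h : ℝ → ℝ} {c r : ℝ} (hr : 0 < r)
    (hd : ∀ x ∈ Icc (c - r) (c + r), DifferentiableAt ℝ h x) :
    evariance h (volume[|Icc (c - r) (c + r)]) ≤
      ∫⁻ s, ENNReal.ofReal (4 * r ^ 2 / 9 * deriv h s ^ 2) ∂(volume[|Icc (c - r) (c + r)]) := by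
  have : IsProbabilityMeasure (volume[|Icc (c - r) (c + r)]) :=
    cond_isProbabilityMeasure_of_finite (by simp [hr]) (by simp)
  have hcont : ContinuousOn h (Icc (c - r) (c + r)) := fun x hx =>
    (hd x hx).continuousAt.continuousWithinAt
  have hLp : MemLp h 2 (volume[|Icc (c - r) (c + r)]) := by
    obtain ⟨C, hC⟩ := isCompact_Icc.exists_bound_of_continuousOn hcont
    refine MemLp.of_bound ?_ C ?_
    · exact (hcont.aestronglyMeasurable measurableSet_Icc).smul_measure _
    · exact ae_cond_of_forall_mem measurableSet_Icc hC
  refine (evariance_le_lintegral_sub_sq hLp (h c)).trans ?_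
  simp only [ENNReal.ofReal_mul (show 0 ≤ 4 * r ^ 2 / 9 by positivity)]
  rw [ProbabilityTheory.cond, lintegral_smul_measure, lintegral_smul_measure,
    lintegral_const_mul _ (by fun_prop)]
  exact mul_le_mul_right (lintegral_sub_mid_sq_le hr hd) _

/-- Poincaré's inequality on a cube, with the gradient measured in the sup norm. -/
lemma evariance_cube_le {g : E3 → ℝ} {c : E3} {r : ℝ} (hr : 0 < r)
    (hd : ∀ x ∈ univ.pi fun i => Icc (c i - r) (c i + r), DifferentiableAt ℝ g x) :
    evariance g (volume[|univ.pi fun i => Icc (c i - r) (c i + r)]) ≤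
      ENNReal.ofReal (4 * r ^ 2 / 3) * ∫⁻ x, ENNReal.ofReal (‖grad3 g x‖ ^ 2)
        ∂(volume[|univ.pi fun i => Icc (c i - r) (c i + r)]) := by
  set Q : Set E3 := univ.pi fun i => Icc (c i - r) (c i + r) with hQ
  have hQm : MeasurableSet Q := MeasurableSet.univ_pi fun i => measurableSet_Icc
  have hp : ∀ i, IsProbabilityMeasure (volume[|Icc (c i - r) (c i + r)]) := fun i =>
    cond_isProbabilityMeasure_of_finite (by simp [hr]) (by simp)
  have hcont : ContinuousOn g Q := fun x hx => (hd x hx).continuousAt.continuousWithinAt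
  obtain ⟨C, hC⟩ := (isCompact_univ_pi fun i => isCompact_Icc).exists_bound_of_continuousOn hcont
  have hF : Continuous (g ∘ cubeProj c r) :=
    hcont.comp_continuous (continuous_cubeProj c r) (cubeProj_mem c hr)
  have hpd : ∀ i, Measurable fun x => pd g i (cubeProj c r x) := fun i =>
    (measurable_fderiv_apply_const ℝ g (Pi.single i 1)).comp (continuous_cubeProj c r).measurable
  have key := evariance_pi_le (fun i => volume[|Icc (c i - r) (c i + r)]) hF.measurable
    (C := C) (fun z => hC _ (cubeProj_mem c hr z))
    (G := fun i x => ENNReal.ofReal (4 * r ^ 2 / 9 * pd g i (cubeProj c r x) ^ 2))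
    (fun i => by have := hpd i; fun_prop) (fun i x => by
      have hmem : ∀ s ∈ Icc (c i - r) (c i + r), Function.update (cubeProj c r x) i s ∈ Q :=
        fun s hs => by rw [← cubeProj_update x hs]; exact cubeProj_mem c hr _
      have hder : ∀ s ∈ Icc (c i - r) (c i + r),
          HasDerivAt (fun s => g (Function.update (cubeProj c r x) i s))
            (pd g i (Function.update (cubeProj c r x) i s)) s := fun s hs =>
        (hd _ (hmem s hs)).hasFDerivAt.comp_hasDerivAt s (hasDerivAt_update _ i s)
      have hae : (fun s => (g ∘ cubeProj c r) (Function.update x i s))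
          =ᵐ[volume[|Icc (c i - r) (c i + r)]]
            fun s => g (Function.update (cubeProj c r x) i s) :=
        ae_cond_of_forall_mem measurableSet_Icc fun s hs => by
          simp only [Function.comp, cubeProj_update x hs]
      rw [evariance_congr hae]
      refine (evariance_cond_Icc_le hr fun s hs => (hder s hs).differentiableAt).trans_eq ?_
      refine lintegral_congr_ae (ae_cond_of_forall_mem measurableSet_Icc fun s hs => ?_)
      simp only [(hder s hs).deriv, cubeProj_update x hs])
  rw [pi_cond_Icc c r hr] at key
  have hae : g ∘ cubeProj c r =ᵐ[volume[|Q]] g :=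
    ae_cond_of_forall_mem hQm fun x hx => by simp only [Function.comp, cubeProj_of_mem hx]
  rw [evariance_congr hae] at key
  have hterm : ∀ i, ∫⁻ x, ENNReal.ofReal (4 * r ^ 2 / 9 * pd g i (cubeProj c r x) ^ 2)
      ∂(volume[|Q]) ≤
        ENNReal.ofReal (4 * r ^ 2 / 9) * ∫⁻ x, ENNReal.ofReal (‖grad3 g x‖ ^ 2) ∂(volume[|Q]) :=
    fun i => by
      have := measurable_norm_grad3 g
      rw [← lintegral_const_mul _ (by fun_prop)]
      refine lintegral_mono_ae (ae_cond_of_forall_mem hQm fun x hx => ?_)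
      rw [cubeProj_of_mem hx, ← ENNReal.ofReal_mul (by positivity)]
      apply ENNReal.ofReal_le_ofReal
      have h1 : |pd g i x| ≤ ‖grad3 g x‖ := norm_le_pi_norm (grad3 g x) i
      rw [← sq_abs (pd g i x)]
      gcongr
  refine key.trans ((Finset.sum_le_sum fun i _ => hterm i).trans_eq ?_)
  rw [Fin.sum_univ_three, ← add_mul, ← add_mul, ← ENNReal.ofReal_add (by positivity) (by positivity),
    ← ENNReal.ofReal_add (by positivity) (by positivity)]
  congr 2
  ring

lemma oscillation_le {g : E3 → ℝ} {c : E3} {r M : ℝ} (hr : 0 < r) (hM : 0 < M)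
    (hd : ∀ x ∈ univ.pi fun i => Icc (c i - r) (c i + r), DifferentiableAt ℝ g x)
    (hw : ∀ s, 0 < s → volume.restrict (univ.pi fun i => Icc (c i - r) (c i + r))
      {x | s < ‖grad3 g x‖} ≤ ENNReal.ofReal (M ^ 3 / s ^ 3)) :
    ((volume (univ.pi fun i => Icc (c i - r) (c i + r))).toReal)⁻¹ *
      ∫ x in univ.pi fun i => Icc (c i - r) (c i + r),
        |g x - avgQ (univ.pi fun i => Icc (c i - r) (c i + r)) g| ≤ M := by
  have hvar := evariance_cube_le hr hd
  set Q : Set E3 := univ.pi fun i => Icc (c i - r) (c i + r) with hQ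
  have hQm : MeasurableSet Q := MeasurableSet.univ_pi fun i => measurableSet_Icc
  have hvol : volume Q = ENNReal.ofReal ((2 * r) ^ 3) := volume_cube c hr
  have hint : ∀ φ : E3 → ℝ, ((volume Q).toReal)⁻¹ * ∫ x in Q, φ x = ∫ x, φ x ∂(volume[|Q]) :=
    fun φ => by rw [ProbabilityTheory.cond, integral_smul_measure, ENNReal.toReal_inv, smul_eq_mul]
  have hP : IsProbabilityMeasure (volume[|Q]) := by
    refine cond_isProbabilityMeasure_of_finite ?_ ?_
    · rw [hvol]; simp [hr]
    · rw [hvol]; exact ENNReal.ofReal_ne_top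
  have hcont : ContinuousOn g Q := fun x hx => (hd x hx).continuousAt.continuousWithinAt
  have hLp : MemLp g 2 (volume[|Q]) := by
    obtain ⟨C, hC⟩ := (isCompact_univ_pi fun i => isCompact_Icc).exists_bound_of_continuousOn hcont
    refine MemLp.of_bound ?_ C (ae_cond_of_forall_mem hQm hC)
    exact (hcont.aestronglyMeasurable hQm).smul_measure _
  have hmass : volume.restrict Q univ ≤ ENNReal.ofReal ((2 * r) ^ 3) := by
    rw [Measure.restrict_apply_univ, hvol]
  have hgrad := lintegral_sq_le_of_meas_lt_le (measurable_norm_grad3 g)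
    (fun x => norm_nonneg _) (L := 2 * r) (by positivity) hM hmass hw
  have hle : evariance g (volume[|Q]) ≤ ENNReal.ofReal (M ^ 2) := by
    refine hvar.trans ?_
    rw [ProbabilityTheory.cond, lintegral_smul_measure, hvol, smul_eq_mul,
      ← ENNReal.ofReal_inv_of_pos (by positivity)]
    refine (mul_le_mul_right (mul_le_mul_right hgrad _) _).trans_eq ?_
    rw [← ENNReal.ofReal_mul (by positivity), ← ENNReal.ofReal_mul (by positivity)]
    congr 1
    field_simp
    norm_num
  rw [← ofReal_variance hLp, ENNReal.ofReal_le_ofReal_iff (by positivity),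
    variance_eq_integral hLp.aemeasurable] at hle
  rw [hint, avgQ, hint]
  have habs := sq_integral_le_integral_sq
    (X := fun x => |g x - ∫ x, g x ∂(volume[|Q])|) (hLp.sub (memLp_const _)).abs
  simp only [sq_abs] at habs
  exact le_of_sq_le_sq (habs.trans hle) hM.le

/-- Sobolev embedding into BMO: if `g ∈ BMO(Ω)` and
`∇g ∈ L(3,∞)(Ω)`, then `‖g‖_{BMO(Ω)} ≤ ‖∇g‖_{L(3,∞)(Ω)}`. -/
theorem bmo_le_weakL3_gradient (Ω : Set E3) (hΩ : BoundedDomain Ω)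
    (g : E3 → ℝ) (hdiff : ∀ x ∈ Ω, DifferentiableAt ℝ g x)
    (hg : MemBMO Ω g)
    (hgrad : lorentzNormV (volume.restrict Ω) (grad3 g) 3 ∞ ≠ ∞) :
    ENNReal.ofReal (bmoNorm Ω g) ≤
      lorentzNormV (volume.restrict Ω) (grad3 g) 3 ∞ := by
  have : IsFiniteMeasure (volume.restrict Ω) :=
    ⟨by simpa using hΩ.2.2.measure_lt_top⟩
  refine le_of_forall_gt fun K hK => ?_
  obtain ⟨K', hNK, hKK⟩ := exists_between hK
  have hK' : K' ≠ ∞ := hKK.ne_top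
  set M := K'.toReal
  have hM : 0 < M := ENNReal.toReal_pos (pos_of_gt hNK).ne' hK'
  have hMK : ENNReal.ofReal M = K' := ENNReal.ofReal_toReal hK'
  rw [← hMK] at hNK hKK
  refine lt_of_le_of_lt (ENNReal.ofReal_le_ofReal ?_) hKK
  refine Real.sSup_le ?_ hM.le
  rintro A ⟨Q, ⟨c, r, hr, rfl⟩, hQΩ, rfl⟩
  rw [cube_eq_pi] at hQΩ ⊢
  refine oscillation_le hr hM (fun x hx => hdiff x (hQΩ hx)) fun s hs => ?_
  have := meas_lt_le_of_lorentzNorm_lt (measurable_norm_grad3 g) hM hNK hs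
  simp only [abs_norm] at this
  exact (Measure.restrict_mono_set _ hQΩ _).trans this

end
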